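/- arXiv:2105.09715 — 2 statements merged into one kernel-verified Lean document; each statement's English description precedes it below -/
import Mathlib

section
/- Let A ∈ B(H). If w(A) = (1/2)√(‖A*A + AA*‖), then ‖Re(A)‖ = ‖Im(A)‖ = (1/2)√(‖A*A + AA*‖). -/
open ContinuousLinearMap Filter
open scoped ComplexInnerProductSpace Topology

variable {H : Type*} [NormedAddCommGroup H] [InnerProductSpace ℂ H]
  [CompleteSpace H] [Nontrivial H]

/-- The numerical range of a bounded linear operator. -/
noncomputable def numRange (A : H →L[ℂ] H) : Set ℂ :=
  {z : ℂ | ∃ x : H, ‖x‖ = 1 ∧ z = ⟪x, A x⟫}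

/-- The numerical radius of a bounded linear operator. -/
noncomputable def numRadius (A : H →L[ℂ] H) : ℝ :=
  sSup {r : ℝ | ∃ x : H, ‖x‖ = 1 ∧ r = ‖(⟪x, A x⟫)‖}

/-- The Crawford number of a bounded linear operator. -/
noncomputable def crawford (A : H →L[ℂ] H) : ℝ :=
  sInf {r : ℝ | ∃ x : H, ‖x‖ = 1 ∧ r = ‖(⟪x, A x⟫)‖}

/-- The real part `(A + A*)/2` of a bounded linear operator. -/
noncomputable def reOp (A : H →L[ℂ] H) : H →L[ℂ] H :=
  (2 : ℂ)⁻¹ • (A + ContinuousLinearMap.adjoint A)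

/-- The imaginary part `(A - A*)/(2i)` of a bounded linear operator. -/
noncomputable def imOp (A : H →L[ℂ] H) : H →L[ℂ] H :=
  (2 * Complex.I)⁻¹ • (A - ContinuousLinearMap.adjoint A)

omit [CompleteSpace H] [Nontrivial H] in
theorem norm_inner_le_numRadius_mul_sq (A : H →L[ℂ] H) (x : H) :
    ‖(⟪x, A x⟫)‖ ≤ numRadius A * ‖x‖ ^ 2 := by
  rcases eq_or_ne x 0 with rfl | hx
  · simp
  have hx' : 0 < ‖x‖ := norm_pos_iff.2 hx
  have hbdd : BddAbove {r : ℝ | ∃ x : H, ‖x‖ = 1 ∧ r = ‖(⟪x, A x⟫)‖} := by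
    refine ⟨‖A‖, ?_⟩
    rintro r ⟨y, hy, rfl⟩
    calc ‖(⟪y, A y⟫)‖ ≤ ‖y‖ * ‖A y‖ := norm_inner_le_norm _ _
      _ ≤ ‖y‖ * (‖A‖ * ‖y‖) := by gcongr; exact A.le_opNorm y
      _ = ‖A‖ := by simp [hy]
  have hmem := le_csSup hbdd ⟨((‖x‖⁻¹ : ℝ) : ℂ) • x, by simp [norm_smul, hx'.ne'], rfl⟩
  simp only [map_smul, inner_smul_left, inner_smul_right, norm_mul, Complex.conj_ofReal,
    Complex.norm_real, norm_inv, norm_norm] at hmem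
  change _ ≤ numRadius A at hmem
  calc ‖(⟪x, A x⟫)‖ = ‖x‖⁻¹ * (‖x‖⁻¹ * ‖(⟪x, A x⟫)‖) * ‖x‖ ^ 2 := by field_simp
    _ ≤ numRadius A * ‖x‖ ^ 2 := by gcongr

omit [CompleteSpace H] [Nontrivial H] in
theorem numRadius_nonneg (A : H →L[ℂ] H) : 0 ≤ numRadius A :=
  Real.sSup_nonneg (by rintro r ⟨x, -, rfl⟩; positivity)

omit [CompleteSpace H] [Nontrivial H] in
theorem norm_le_numRadius_of_isSymmetric {A T : H →L[ℂ] H} (hT : T.IsSymmetric)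
    (hle : ∀ x, ‖(⟪x, T x⟫)‖ ≤ ‖(⟪x, A x⟫)‖) : ‖T‖ ≤ numRadius A := by
  rw [norm_eq_iSup_rayleighQuotient T hT]
  refine ciSup_le fun x => ?_
  rw [rayleighQuotient, abs_div, abs_of_nonneg (sq_nonneg ‖x‖)]
  refine div_le_of_le_mul₀ (sq_nonneg _) (numRadius_nonneg A) ?_
  refine le_trans ?_ ((hle x).trans (norm_inner_le_numRadius_mul_sq A x))
  rw [reApplyInnerSelf_apply, norm_inner_symm]
  exact RCLike.abs_re_le_norm _

omit [Nontrivial H] in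
theorem inner_reOp (A : H →L[ℂ] H) (x : H) : ⟪x, reOp A x⟫ = ((⟪x, A x⟫).re : ℂ) := by
  rw [reOp, smul_apply, add_apply, inner_smul_right, inner_add_right, adjoint_inner_right,
    ← inner_conj_symm (A x) x, Complex.add_conj]
  push_cast
  ring

omit [Nontrivial H] in
theorem inner_imOp (A : H →L[ℂ] H) (x : H) : ⟪x, imOp A x⟫ = ((⟪x, A x⟫).im : ℂ) := by
  rw [imOp, smul_apply, sub_apply, inner_smul_right, inner_sub_right, adjoint_inner_right,
    ← inner_conj_symm (A x) x, Complex.sub_conj]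
  field_simp
  push_cast
  ring

omit [Nontrivial H] in
theorem isSelfAdjoint_reOp (A : H →L[ℂ] H) : IsSelfAdjoint (reOp A) := by
  rw [IsSelfAdjoint, reOp, ← star_eq_adjoint, star_smul, star_add, star_star, add_comm]
  simp

omit [Nontrivial H] in
theorem isSelfAdjoint_imOp (A : H →L[ℂ] H) : IsSelfAdjoint (imOp A) := by
  rw [IsSelfAdjoint, imOp, ← star_eq_adjoint, star_smul, star_sub, star_star, ← neg_sub A,
    smul_neg, ← neg_smul]
  simp

omit [Nontrivial H] in
theorem norm_reOp_le_numRadius (A : H →L[ℂ] H) : ‖reOp A‖ ≤ numRadius A :=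
  norm_le_numRadius_of_isSymmetric (isSelfAdjoint_reOp A).isSymmetric fun x => by
    rw [inner_reOp, Complex.norm_real]
    exact Complex.abs_re_le_norm _

omit [Nontrivial H] in
theorem norm_imOp_le_numRadius (A : H →L[ℂ] H) : ‖imOp A‖ ≤ numRadius A :=
  norm_le_numRadius_of_isSymmetric (isSelfAdjoint_imOp A).isSymmetric fun x => by
    rw [inner_imOp, Complex.norm_real]
    exact Complex.abs_im_le_norm _

omit [Nontrivial H] in
theorem adjoint_comp_self_add_self_comp_adjoint (A : H →L[ℂ] H) :
    adjoint A ∘L A + A ∘L adjoint A = (2 : ℂ) • (reOp A * reOp A + imOp A * imOp A) := by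
  change adjoint A * A + A * adjoint A = _
  have hI : (2 * Complex.I)⁻¹ * (2 * Complex.I)⁻¹ = -(2⁻¹ * 2⁻¹ : ℂ) := by
    rw [← mul_inv, ← mul_inv, ← inv_neg]
    congr 1
    linear_combination 4 * Complex.I_mul_I
  simp only [reOp, imOp, smul_mul_smul_comm, hI, mul_add, add_mul, mul_sub, sub_mul]
  module

omit [Nontrivial H] in
theorem norm_adjoint_comp_self_add_self_comp_adjoint_le (A : H →L[ℂ] H) :
    ‖adjoint A ∘L A + A ∘L adjoint A‖ ≤ 2 * (‖reOp A‖ ^ 2 + ‖imOp A‖ ^ 2) := by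
  rw [adjoint_comp_self_add_self_comp_adjoint, norm_smul, Complex.norm_ofNat, sq, sq]
  gcongr
  exact (norm_add_le _ _).trans (add_le_add (norm_mul_le _ _) (norm_mul_le _ _))

/-- If `w(A) = (1/2)√‖A*A + AA*‖`, then `‖Re(A)‖ = ‖Im(A)‖ = (1/2)√‖A*A + AA*‖`. -/
theorem stmt11 (A : H →L[ℂ] H)
    (h : numRadius A = (1 / 2) * Real.sqrt ‖adjoint A ∘L A + A ∘L adjoint A‖) :
    ‖reOp A‖ = (1 / 2) * Real.sqrt ‖adjoint A ∘L A + A ∘L adjoint A‖ ∧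
      ‖imOp A‖ = (1 / 2) * Real.sqrt ‖adjoint A ∘L A + A ∘L adjoint A‖ := by
  have hsq : 4 * numRadius A ^ 2 = ‖adjoint A ∘L A + A ∘L adjoint A‖ := by
    rw [h, mul_pow, Real.sq_sqrt (norm_nonneg _)]
    ring
  have hnorm := norm_adjoint_comp_self_add_self_comp_adjoint_le A
  have hre := norm_reOp_le_numRadius A
  have him := norm_imOp_le_numRadius A
  have hre_sq := pow_le_pow_left₀ (norm_nonneg _) hre 2
  have him_sq := pow_le_pow_left₀ (norm_nonneg _) him 2
  rw [← h]
  exact ⟨hre.antisymm (pow_le_pow_iff_left₀ (numRadius_nonneg A) (norm_nonneg _) two_ne_zero |>.1 (by linarith)),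
    him.antisymm (pow_le_pow_iff_left₀ (numRadius_nonneg A) (norm_nonneg _) two_ne_zero |>.1 (by linarith))⟩
end

section
/- Let A ∈ B(H). Then w(A) = (1/2)√(‖A*A + AA*‖) if and only if the closure of W(A) is the closed disk {z ∈ ℂ : |z| ≤ (1/2)√(‖A*A + AA*‖)} centered at the origin with radius (1/2)√(‖A*A + AA*‖). -/
open ContinuousLinearMap Filter
open scoped ComplexInnerProductSpace Topology

variable {H : Type*} [NormedAddCommGroup H] [InnerProductSpace ℂ H]
  [CompleteSpace H] [Nontrivial H]

section

variable {E : Type*} [NormedAddCommGroup E] [InnerProductSpace ℂ E]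

theorem exists_unit_inner_self_eq (B : E →L[ℂ] E) {v : E} (hv : v ≠ 0) :
    ∃ u, ‖u‖ = 1 ∧ ⟪v, B v⟫ = ((‖v‖ ^ 2 : ℝ) : ℂ) * ⟪u, B u⟫ := by
  have hv' : (‖v‖ : ℂ) ≠ 0 := by simpa using hv
  refine ⟨(‖v‖ : ℂ)⁻¹ • v, norm_smul_inv_norm hv, ?_⟩
  rw [map_smul, inner_smul_left, inner_smul_right, map_inv₀, Complex.conj_ofReal]
  push_cast
  field_simp

theorem norm_inner_self_le_of_unit (B : E →L[ℂ] E) {r : ℝ}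
    (h : ∀ x, ‖x‖ = 1 → ‖⟪x, B x⟫‖ ≤ r) (x : E) : ‖⟪x, B x⟫‖ ≤ r * ‖x‖ ^ 2 := by
  rcases eq_or_ne x 0 with rfl | hx
  · simp
  obtain ⟨u, hu, hxu⟩ := exists_unit_inner_self_eq B hx
  rw [hxu, norm_mul, Complex.norm_real, Real.norm_of_nonneg (sq_nonneg _), mul_comm]
  gcongr
  exact h u hu

theorem re_inner_self_le_of_unit (B : E →L[ℂ] E) {r : ℝ}
    (h : ∀ x, ‖x‖ = 1 → (⟪x, B x⟫).re ≤ r) (x : E) : (⟪x, B x⟫).re ≤ r * ‖x‖ ^ 2 := by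
  rcases eq_or_ne x 0 with rfl | hx
  · simp
  obtain ⟨u, hu, hxu⟩ := exists_unit_inner_self_eq B hx
  rw [hxu, Complex.re_ofReal_mul, mul_comm]
  gcongr
  exact h u hu

theorem norm_inner_le_numRadius (A : E →L[ℂ] E) {x : E} (hx : ‖x‖ = 1) :
    ‖⟪x, A x⟫‖ ≤ numRadius A := by
  refine le_csSup ⟨‖A‖, ?_⟩ ⟨x, hx, rfl⟩
  rintro _ ⟨y, hy, rfl⟩
  refine (norm_inner_le_norm _ _).trans ?_
  simpa [hy] using A.le_opNorm y

/-- The **Toeplitz–Hausdorff theorem**: the numerical range is convex. -/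
theorem convex_numRange (A : E →L[ℂ] E) : Convex ℝ (numRange A) := by
  rw [convex_iff_segment_subset]
  rintro _ ⟨x, hx, rfl⟩ _ ⟨y, hy, rfl⟩ z hz
  set a := ⟪x, A x⟫ with ha
  set b := ⟪y, A y⟫ with hb
  rw [segment_eq_image_lineMap] at hz
  obtain ⟨t, ht, rfl⟩ := hz
  rcases eq_or_ne b a with hab | hab
  · exact ⟨x, hx, by simp [hab, ← ha]⟩
  have hd : b - a ≠ 0 := sub_ne_zero.2 hab
  set p := ⟪x, A y⟫ - a * ⟪x, y⟫ with hp
  set q := ⟪y, A x⟫ - a * ⟪y, x⟫ with hq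
  obtain ⟨c, hc, hcim⟩ : ∃ c : ℂ, ‖c‖ = 1 ∧
      (((starRingEnd ℂ) c * p + c * q) / (b - a)).im = 0 := by
    set m := q / (b - a) - (starRingEnd ℂ) (p / (b - a)) with hm
    obtain ⟨c, hc, hcm⟩ : ∃ c : ℂ, ‖c‖ = 1 ∧ (c * m).im = 0 := by
      rcases eq_or_ne m 0 with h | h
      · exact ⟨1, by simp, by simp [h]⟩
      · have h' : (‖m‖ : ℂ) ≠ 0 := by simpa using h
        refine ⟨(‖m‖ : ℂ) / m, by simp [h], ?_⟩
        rw [div_mul_cancel₀ _ h, Complex.ofReal_im]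
    refine ⟨c, hc, ?_⟩
    have e : ((starRingEnd ℂ) c * p + c * q) / (b - a) =
        c * m + (c * (starRingEnd ℂ) (p / (b - a)) +
          (starRingEnd ℂ) (c * (starRingEnd ℂ) (p / (b - a)))) := by
      rw [hm, map_mul, Complex.conj_conj]
      ring
    rw [e, Complex.add_im, hcm, Complex.add_conj, zero_add, Complex.ofReal_im]
  set k := (((starRingEnd ℂ) c * p + c * q) / (b - a)).re with hk
  have hk' : (starRingEnd ℂ) c * p + c * q = k * (b - a) := by
    rw [← div_eq_iff hd]
    exact Complex.ext (by simp [hk]) (by simpa using hcim)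
  let v : ℝ → E := fun s => (((1 - s : ℝ) : ℂ) * c) • x + (s : ℂ) • y
  have hvc : Continuous v := by fun_prop
  have hxx : ⟪x, x⟫ = 1 := by rw [inner_self_eq_norm_sq_to_K, hx]; simp
  have hyy : ⟪y, y⟫ = 1 := by rw [inner_self_eq_norm_sq_to_K, hy]; simp
  have hform : ∀ s, ⟪v s, A (v s)⟫ =
      a * ((‖v s‖ ^ 2 : ℝ) : ℂ) + ((s ^ 2 + s * (1 - s) * k : ℝ) : ℂ) * (b - a) := by
    intro s
    have hn : ((‖v s‖ ^ 2 : ℝ) : ℂ) = ⟪v s, v s⟫ := by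
      rw [inner_self_eq_norm_sq_to_K]; norm_cast
    rw [hn]
    simp only [v, map_add, map_smul, inner_add_left, inner_add_right, inner_smul_left,
      inner_smul_right, map_mul, Complex.conj_ofReal, hxx, hyy, ← ha, ← hb]
    push_cast
    have hp' : ⟪x, A y⟫ = p + a * ⟪x, y⟫ := by rw [hp]; ring
    have hq' : ⟪y, A x⟫ = q + a * ⟪y, x⟫ := by rw [hq]; ring
    rw [hp', hq']
    linear_combination (s : ℂ) * (1 - s) * hk'
  have hv0 : ∀ s, v s ≠ 0 := by
    intro s hs
    have h1 : (s : ℂ) • y = (-(((1 - s : ℝ) : ℂ) * c)) • x := by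
      rw [neg_smul, eq_neg_iff_add_eq_zero, add_comm]; exact hs
    have hs0 : s ≠ 0 := by
      rintro rfl
      have : c = 0 ∨ x = 0 := by simpa using h1.symm
      rcases this with rfl | rfl <;> simp at hc hx
    have h2 : y = ((s : ℂ)⁻¹ * (-(((1 - s : ℝ) : ℂ) * c))) • x := by
      rw [mul_smul, ← h1, inv_smul_smul₀ (by exact_mod_cast hs0)]
    generalize (s : ℂ)⁻¹ * (-(((1 - s : ℝ) : ℂ) * c)) = l at h2
    have hl : ‖l‖ = 1 := by
      rw [h2, norm_smul, hx, mul_one] at hy; exact hy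
    apply hab
    rw [hb, h2, map_smul, inner_smul_left, inner_smul_right, ← mul_assoc, Complex.conj_mul', hl,
      ← ha]
    simp
  have hcont : ContinuousOn (fun s : ℝ => (s ^ 2 + s * (1 - s) * k) / ‖v s‖ ^ 2) (Set.Icc 0 1) :=
    ((by fun_prop : Continuous fun s : ℝ => s ^ 2 + s * (1 - s) * k).div
      (hvc.norm.pow 2) fun s => by simpa using hv0 s).continuousOn
  obtain ⟨s, -, hst⟩ := intermediate_value_Icc zero_le_one hcont
    (show t ∈ Set.Icc _ _ by simpa [v, hy] using ht)
  obtain ⟨u, hu, huv⟩ := exists_unit_inner_self_eq A (hv0 s)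
  refine ⟨u, hu, ?_⟩
  have hN : ((‖v s‖ ^ 2 : ℝ) : ℂ) ≠ 0 := by simpa using hv0 s
  refine mul_left_cancel₀ hN ?_
  have hst' : s ^ 2 + s * (1 - s) * k = t * ‖v s‖ ^ 2 := by
    rw [← hst]
    exact (div_mul_cancel₀ _ (by simpa using hv0 s)).symm
  rw [← huv, hform, hst', AffineMap.lineMap_apply_module', Complex.real_smul]
  push_cast
  ring

theorem numRadius_eq_of_closure_numRange_eq [Nontrivial E] (A : E →L[ℂ] E) {r : ℝ}
    (hr : 0 ≤ r)
    (h : closure (numRange A) = Metric.closedBall 0 r) : numRadius A = r := by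
  refine le_antisymm (csSup_le ?_ ?_) (le_of_forall_pos_le_add fun ε hε => ?_)
  · obtain ⟨y, hy⟩ := exists_norm_eq E zero_le_one
    exact ⟨_, y, hy, rfl⟩
  · rintro _ ⟨x, hx, rfl⟩
    rw [← mem_closedBall_zero_iff, ← h]
    exact subset_closure ⟨x, hx, rfl⟩
  · have hmem : (r : ℂ) ∈ closure (numRange A) := by
      rw [h, mem_closedBall_zero_iff, Complex.norm_real, Real.norm_of_nonneg hr]
    obtain ⟨_, ⟨x, hx, rfl⟩, hd⟩ := Metric.mem_closure_iff.1 hmem ε hε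
    have h1 := norm_le_norm_add_norm_sub' (r : ℂ) ⟪x, A x⟫
    rw [Complex.norm_real, Real.norm_of_nonneg hr, ← dist_eq_norm] at h1
    linarith [norm_inner_le_numRadius A hx]

variable [CompleteSpace E]

theorem reOp_isSelfAdjoint (B : E →L[ℂ] E) : IsSelfAdjoint (reOp B) := by
  rw [isSelfAdjoint_iff', reOp, map_smulₛₗ, map_add, adjoint_adjoint, add_comm]
  simp [Complex.conj_ofNat]

theorem imOp_isSelfAdjoint (B : E →L[ℂ] E) : IsSelfAdjoint (imOp B) := by
  rw [isSelfAdjoint_iff', imOp, map_smulₛₗ, map_sub, adjoint_adjoint, ← neg_sub B, smul_neg,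
    ← neg_smul]
  simp [Complex.conj_ofNat]

theorem inner_reOp_self (B : E →L[ℂ] E) (x : E) : ⟪x, reOp B x⟫ = ((⟪x, B x⟫).re : ℂ) := by
  have h : ⟪x, adjoint B x⟫ = (starRingEnd ℂ) ⟪x, B x⟫ := by
    rw [adjoint_inner_right, inner_conj_symm]
  simp only [reOp, smul_apply, add_apply, inner_smul_right, inner_add_right, h, Complex.add_conj]
  push_cast
  ring

theorem inner_imOp_self (B : E →L[ℂ] E) (x : E) : ⟪x, imOp B x⟫ = ((⟪x, B x⟫).im : ℂ) := by
  have h : ⟪x, adjoint B x⟫ = (starRingEnd ℂ) ⟪x, B x⟫ := by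
    rw [adjoint_inner_right, inner_conj_symm]
  simp only [imOp, smul_apply, sub_apply, inner_smul_right, inner_sub_right, h, Complex.sub_conj]
  push_cast
  field_simp

theorem norm_reOp_sq_add_norm_imOp_sq (B : E →L[ℂ] E) (x : E) :
    ‖reOp B x‖ ^ 2 + ‖imOp B x‖ ^ 2 = (‖B x‖ ^ 2 + ‖adjoint B x‖ ^ 2) / 2 := by
  have h := parallelogram_law_with_norm ℂ (B x) (adjoint B x)
  simp only [reOp, imOp, smul_apply, add_apply, sub_apply, norm_smul, norm_inv, norm_mul,
    Complex.norm_I, Complex.norm_ofNat]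
  linarith

/-- A self-adjoint operator is bounded in norm by any bound on its quadratic form. -/
theorem norm_le_of_isSelfAdjoint {S : E →L[ℂ] E} (hS : IsSelfAdjoint S) {c : ℝ} (hc : 0 ≤ c)
    (h : ∀ x, ‖⟪x, S x⟫‖ ≤ c * ‖x‖ ^ 2) : ‖S‖ ≤ c := by
  rw [norm_eq_iSup_rayleighQuotient S hS.isSymmetric]
  refine ciSup_le fun x => ?_
  rw [rayleighQuotient, abs_div, abs_of_nonneg (sq_nonneg ‖x‖)]
  refine div_le_of_le_mul₀ (sq_nonneg _) hc (le_trans ?_ (h x))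
  rw [reApplyInnerSelf_apply, ← norm_inner_symm]
  exact Complex.abs_re_le_norm _

theorem norm_apply_apply_sub_sq_le {S : E →L[ℂ] E} (hS : IsSelfAdjoint S) {k : ℝ}
    (h : ∀ x, ‖S x‖ ^ 2 ≤ k * ‖x‖ ^ 2) (x : E) :
    ‖S (S x) - (k : ℂ) • x‖ ^ 2 ≤ k * (k * ‖x‖ ^ 2 - ‖S x‖ ^ 2) := by
  have e : RCLike.re ⟪S (S x), (k : ℂ) • x⟫ = k * ‖S x‖ ^ 2 := by
    have : ⟪S (S x), x⟫ = ⟪S x, S x⟫ := hS.isSymmetric (S x) x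
    rw [inner_smul_right, this, inner_self_eq_norm_sq_to_K]
    exact (Complex.re_ofReal_mul _ _).trans (by norm_cast)
  rw [@norm_sub_sq ℂ, e, norm_smul, mul_pow]
  have := h (S x)
  simp only [Complex.norm_real, Real.norm_eq_abs, sq_abs]
  linarith

theorem tendsto_apply_apply_sub_zero {S : E →L[ℂ] E} (hS : IsSelfAdjoint S) {k : ℝ} (hk : 0 ≤ k)
    (h : ∀ x, ‖S x‖ ^ 2 ≤ k * ‖x‖ ^ 2) {x : ℕ → E} (hx : ∀ n, ‖x n‖ = 1) {e : ℕ → ℝ}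
    (he : Tendsto e atTop (𝓝 0)) (hSe : ∀ n, k - ‖S (x n)‖ ^ 2 ≤ e n) :
    Tendsto (fun n => S (S (x n)) - (k : ℂ) • x n) atTop (𝓝 0) := by
  rw [tendsto_zero_iff_norm_tendsto_zero]
  have h1 : Tendsto (fun n => ‖S (S (x n)) - (k : ℂ) • x n‖ ^ 2) atTop (𝓝 0) := by
    refine squeeze_zero (fun n => sq_nonneg _) (fun n => ?_) (by simpa using he.const_mul k)
    refine (norm_apply_apply_sub_sq_le hS h (x n)).trans ?_
    rw [hx n]
    exact mul_le_mul_of_nonneg_left (by linarith [hSe n]) hk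
  simpa using h1.sqrt

/-- If the quadratic form of `B` is bounded by `r` on unit vectors and `‖Bx‖² + ‖B*x‖²` comes
arbitrarily close to `4r²` there, then the real part of the quadratic form comes arbitrarily close
to `r`. -/
theorem exists_unit_re_inner_gt (B : E →L[ℂ] E) {r δ : ℝ} (hr : 0 < r) (hδ : 0 < δ)
    (hB : ∀ x, ‖⟪x, B x⟫‖ ≤ r * ‖x‖ ^ 2) {x : ℕ → E} (hx : ∀ n, ‖x n‖ = 1)
    (hlim : Tendsto (fun n => ‖B (x n)‖ ^ 2 + ‖adjoint B (x n)‖ ^ 2) atTop (𝓝 (4 * r ^ 2))) :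
    ∃ y, ‖y‖ = 1 ∧ r - δ < (⟪y, B y⟫).re := by
  by_contra! hcon
  set R := reOp B with hR
  set J := imOp B with hJ
  have hRs : IsSelfAdjoint R := reOp_isSelfAdjoint B
  have hJs : IsSelfAdjoint J := imOp_isSelfAdjoint B
  have key : ∀ {S : E →L[ℂ] E} {c k : ℝ}, IsSelfAdjoint S → 0 ≤ c → c ^ 2 = k →
      (∀ x, ‖⟪x, S x⟫‖ ≤ c * ‖⟪x, B x⟫‖) → ∀ x, ‖S x‖ ^ 2 ≤ k * r ^ 2 * ‖x‖ ^ 2 := by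
    intro S c k hS hc hk h x
    have h1 : ‖S‖ ≤ c * r := norm_le_of_isSelfAdjoint hS (by positivity) fun x =>
      (h x).trans (by rw [mul_assoc]; exact mul_le_mul_of_nonneg_left (hB x) hc)
    calc ‖S x‖ ^ 2 ≤ (c * r * ‖x‖) ^ 2 := by gcongr; exact S.le_of_opNorm_le h1 x
      _ = _ := by rw [← hk]; ring
  have hRb : ∀ x, ‖R x‖ ^ 2 ≤ 1 * r ^ 2 * ‖x‖ ^ 2 := key hRs zero_le_one (by norm_num) fun x => by
    rw [inner_reOp_self, Complex.norm_real, one_mul]; exact Complex.abs_re_le_norm _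
  have hJb : ∀ x, ‖J x‖ ^ 2 ≤ 1 * r ^ 2 * ‖x‖ ^ 2 := key hJs zero_le_one (by norm_num) fun x => by
    rw [inner_imOp_self, Complex.norm_real, one_mul]; exact Complex.abs_im_le_norm _
  have hab : ∀ z : ℂ, |z.re| + |z.im| ≤ √2 * ‖z‖ := fun z => by
    refine abs_le_of_sq_le_sq' ?_ (by positivity) |>.2
    rw [mul_pow, Real.sq_sqrt zero_le_two, ← Complex.normSq_eq_norm_sq, Complex.normSq_apply]
    nlinarith [sq_nonneg (|z.re| - |z.im|), sq_abs z.re, sq_abs z.im]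
  have hPb : ∀ x, ‖(R + J) x‖ ^ 2 ≤ 2 * r ^ 2 * ‖x‖ ^ 2 :=
    key (hRs.add hJs) (Real.sqrt_nonneg 2) (Real.sq_sqrt zero_le_two) fun x => by
      rw [add_apply, inner_add_right, inner_reOp_self, inner_imOp_self, ← Complex.ofReal_add,
        Complex.norm_real]
      exact (abs_add_le _ _).trans (hab _)
  have hMb : ∀ x, ‖(R - J) x‖ ^ 2 ≤ 2 * r ^ 2 * ‖x‖ ^ 2 :=
    key (hRs.sub hJs) (Real.sqrt_nonneg 2) (Real.sq_sqrt zero_le_two) fun x => by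
      rw [sub_apply, inner_sub_right, inner_reOp_self, inner_imOp_self, ← Complex.ofReal_sub,
        Complex.norm_real]
      exact (abs_sub _ _).trans (hab _)
  have he : Tendsto (fun n => 4 * r ^ 2 - (‖B (x n)‖ ^ 2 + ‖adjoint B (x n)‖ ^ 2)) atTop (𝓝 0) := by
    exact sub_self (4 * r ^ 2) ▸ hlim.const_sub (4 * r ^ 2)
  have hsum := fun n => norm_reOp_sq_add_norm_imOp_sq B (x n)
  have hRJ : ∀ n, ‖R (x n)‖ ^ 2 ≤ r ^ 2 ∧ ‖J (x n)‖ ^ 2 ≤ r ^ 2 ∧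
      ‖(R - J) (x n)‖ ^ 2 ≤ 2 * r ^ 2 := fun n =>
    ⟨by simpa [hx n] using hRb (x n), by simpa [hx n] using hJb (x n),
      by simpa [hx n] using hMb (x n)⟩
  have tR := tendsto_apply_apply_sub_zero hRs (by positivity) hRb hx he fun n => by
    linarith [hsum n, hRJ n, sq_nonneg ‖R (x n)‖, sq_nonneg ‖J (x n)‖]
  have tJ := tendsto_apply_apply_sub_zero hJs (by positivity) hJb hx he fun n => by
    linarith [hsum n, hRJ n, sq_nonneg ‖R (x n)‖, sq_nonneg ‖J (x n)‖]
  have tP := tendsto_apply_apply_sub_zero (hRs.add hJs) (by positivity) hPb hx he fun n => by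
    have h := parallelogram_law_with_norm ℂ (R (x n)) (J (x n))
    rw [← add_apply, ← sub_apply] at h
    linarith [hsum n, hRJ n]
  have tC : Tendsto (fun n => R (J (x n)) + J (R (x n))) atTop (𝓝 0) := by
    have := (tP.sub tR).sub tJ
    simp only [sub_zero] at this
    refine this.congr fun n => ?_
    simp only [add_apply, map_add]
    push_cast
    module
  have hlow : ∀ v, δ * ‖v‖ ≤ ‖(r : ℂ) • v - R v‖ := by
    intro v
    rcases eq_or_ne v 0 with rfl | hv
    · simp
    have h1 : (⟪v, (r : ℂ) • v - R v⟫).re = r * ‖v‖ ^ 2 - (⟪v, B v⟫).re := by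
      rw [inner_sub_right, inner_smul_right, inner_reOp_self, inner_self_eq_norm_sq_to_K,
        Complex.sub_re, Complex.ofReal_re, Complex.re_ofReal_mul]
      norm_cast
    have h2 := (Complex.re_le_norm _).trans (norm_inner_le_norm v ((r : ℂ) • v - R v))
    have h3 := re_inner_self_le_of_unit B hcon v
    refine le_of_mul_le_mul_left ?_ (norm_pos_iff.2 hv)
    linarith
  have small : ∀ v : ℕ → E, Tendsto (fun n => (r : ℂ) • v n - R (v n)) atTop (𝓝 0) →
      Tendsto v atTop (𝓝 0) := by
    intro v hv
    rw [tendsto_zero_iff_norm_tendsto_zero] at hv ⊢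
    refine squeeze_zero (fun n => norm_nonneg _) (fun n => ?_) (by simpa using hv.const_mul δ⁻¹)
    rw [le_inv_mul_iff₀ hδ]
    exact hlow _
  have s1 : Tendsto (fun n => (r : ℂ) • x n + R (x n)) atTop (𝓝 0) := by
    refine small _ ?_
    have := tR.neg
    rw [neg_zero] at this
    refine this.congr fun n => ?_
    simp only [map_add, map_smul]
    push_cast
    module
  have s2 : Tendsto (fun n => J (x n)) atTop (𝓝 0) := by
    refine small _ ?_
    have := ((J.continuous.tendsto 0).comp s1).sub tC
    simp only [map_zero, sub_zero] at this
    refine this.congr fun n => ?_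
    simp only [Function.comp_apply, map_add, map_smul]
    module
  have s3 : Tendsto (fun n => ((1 * r ^ 2 : ℝ) : ℂ) • x n) atTop (𝓝 0) := by
    have := ((J.continuous.tendsto 0).comp s2).sub tJ
    simp only [map_zero, sub_zero] at this
    refine this.congr fun n => ?_
    simp
  have s4 := s3.norm
  simp only [norm_smul, hx, Complex.norm_real, norm_zero] at s4
  have := tendsto_nhds_unique s4 tendsto_const_nhds
  simp at this
  exact (pow_pos hr 2).ne this

theorem inner_adjoint_comp_add_comp_adjoint_self (A : E →L[ℂ] E) (x : E) :
    ⟪x, (adjoint A ∘L A + A ∘L adjoint A) x⟫ = ((‖A x‖ ^ 2 + ‖adjoint A x‖ ^ 2 : ℝ) : ℂ) := by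
  rw [add_apply, comp_apply, comp_apply, inner_add_right, adjoint_inner_right,
    ← adjoint_inner_left A (adjoint A x), inner_self_eq_norm_sq_to_K, inner_self_eq_norm_sq_to_K]
  norm_cast

variable [Nontrivial E]

theorem exists_unit_seq_tendsto_norm_adjoint_comp_add (A : E →L[ℂ] E) :
    ∃ x : ℕ → E, (∀ n, ‖x n‖ = 1) ∧
      Tendsto (fun n => ‖A (x n)‖ ^ 2 + ‖adjoint A (x n)‖ ^ 2) atTop
        (𝓝 ‖adjoint A ∘L A + A ∘L adjoint A‖) := by
  set M := adjoint A ∘L A + A ∘L adjoint A with hM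
  have hin : ∀ x, ‖⟪x, M x⟫‖ = ‖A x‖ ^ 2 + ‖adjoint A x‖ ^ 2 := fun x => by
    rw [inner_adjoint_comp_add_comp_adjoint_self, Complex.norm_real,
      Real.norm_of_nonneg (by positivity)]
  have hMs : IsSelfAdjoint M :=
    (IsSelfAdjoint.star_mul_self A).add (IsSelfAdjoint.mul_star_self A)
  have hex : ∀ n : ℕ, ∃ x : E, ‖x‖ = 1 ∧
      ‖M‖ - 1 / ((n : ℝ) + 1) < ‖A x‖ ^ 2 + ‖adjoint A x‖ ^ 2 := by
    intro n
    by_contra! h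
    obtain ⟨y, hy⟩ := exists_norm_eq E zero_le_one
    have hc : 0 ≤ ‖M‖ - 1 / ((n : ℝ) + 1) := le_trans (by positivity) (h y hy)
    have := norm_le_of_isSelfAdjoint hMs hc
      (norm_inner_self_le_of_unit M fun x hx => (hin x).trans_le (h x hx))
    have : 0 < 1 / ((n : ℝ) + 1) := by positivity
    linarith
  choose x hx hlt using hex
  refine ⟨x, hx, tendsto_of_tendsto_of_tendsto_of_le_of_le
    (by simpa using tendsto_one_div_add_atTop_nhds_zero_nat.const_sub ‖M‖) tendsto_const_nhds
    (fun n => (hlt n).le) fun n => ?_⟩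
  simp only [← hin]
  refine (norm_inner_le_norm _ _).trans ?_
  simpa [hx n] using M.le_opNorm (x n)

/-- If `w(A) = r` and `‖A*A + AA*‖ = 4r²`, the circle of radius `r` lies in the closure of the
numerical range. -/
theorem sphere_subset_closure_numRange (A : E →L[ℂ] E) {r : ℝ} (hr : 0 < r)
    (hw : numRadius A = r) (hM : ‖adjoint A ∘L A + A ∘L adjoint A‖ = 4 * r ^ 2) :
    Metric.sphere (0 : ℂ) r ⊆ closure (numRange A) := by
  intro z hz
  rw [mem_sphere_zero_iff_norm] at hz
  obtain ⟨u, hu, rfl⟩ : ∃ u : ℂ, ‖u‖ = 1 ∧ z = u * r :=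
    ⟨z / r, by simp [hz, hr.ne', abs_of_pos hr], by
      rw [div_mul_cancel₀]; exact_mod_cast hr.ne'⟩
  obtain ⟨x, hx, hlim⟩ := exists_unit_seq_tendsto_norm_adjoint_comp_add A
  set B := (starRingEnd ℂ) u • A with hB
  have hBA : ∀ y, ⟪y, A y⟫ = u * ⟪y, B y⟫ := fun y => by
    rw [hB, smul_apply, inner_smul_right, ← mul_assoc, Complex.mul_conj', hu]; simp
  have hBn : ∀ y, ‖y‖ = 1 → ‖⟪y, B y⟫‖ ≤ r := fun y hy => by
    have := norm_inner_le_numRadius A hy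
    rwa [hBA, norm_mul, hu, one_mul, hw] at this
  have hlim' : Tendsto (fun n => ‖B (x n)‖ ^ 2 + ‖adjoint B (x n)‖ ^ 2) atTop
      (𝓝 (4 * r ^ 2)) := by
    rw [← hM]
    refine hlim.congr fun n => ?_
    rw [hB, map_smulₛₗ, smul_apply, smul_apply, norm_smul, norm_smul, Complex.conj_conj,
      Complex.norm_conj, hu, one_mul, one_mul]
  rw [Metric.mem_closure_iff]
  intro ε hε
  obtain ⟨y, hy, hlt⟩ := exists_unit_re_inner_gt B hr (δ := ε ^ 2 / (2 * r)) (by positivity)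
    (norm_inner_self_le_of_unit B hBn) hx hlim'
  refine ⟨_, ⟨y, hy, rfl⟩, ?_⟩
  have hn := hBn y hy
  rw [dist_eq_norm, hBA, ← mul_sub, norm_mul, hu, one_mul]
  generalize ⟪y, B y⟫ = w at hlt hn
  refine lt_of_pow_lt_pow_left₀ 2 hε.le ?_
  have hn2 : ‖w‖ ^ 2 ≤ r ^ 2 := by gcongr
  rw [← Complex.normSq_eq_norm_sq, Complex.normSq_apply] at hn2 ⊢
  rw [sub_lt_comm, lt_div_iff₀ (by positivity)] at hlt
  simp only [Complex.sub_re, Complex.sub_im, Complex.ofReal_re, Complex.ofReal_im]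
  linarith

theorem closure_numRange_eq_of_numRadius_eq (A : E →L[ℂ] E) {r : ℝ} (hr : 0 ≤ r)
    (hw : numRadius A = r) (hM : ‖adjoint A ∘L A + A ∘L adjoint A‖ = 4 * r ^ 2) :
    closure (numRange A) = Metric.closedBall 0 r := by
  have hsub : numRange A ⊆ Metric.closedBall 0 r := by
    rintro _ ⟨x, hx, rfl⟩
    rw [mem_closedBall_zero_iff, ← hw]
    exact norm_inner_le_numRadius A hx
  refine (closure_minimal hsub Metric.isClosed_closedBall).antisymm ?_
  rcases hr.eq_or_lt with rfl | hr
  · rw [Metric.closedBall_zero] at hsub ⊢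
    obtain ⟨y, hy⟩ := exists_norm_eq E zero_le_one
    have hmem : ⟪y, A y⟫ ∈ numRange A := ⟨y, hy, rfl⟩
    rw [Set.singleton_subset_iff, ← hsub hmem]
    exact subset_closure hmem
  · rw [← convexHull_sphere_eq_closedBall 0 hr.le]
    exact convexHull_min (sphere_subset_closure_numRange A hr hw hM) (convex_numRange A).closure

end

/-- `w(A) = (1/2)√‖A*A + AA*‖` iff the closure of `W(A)` is the closed disk centered at
the origin of radius `(1/2)√‖A*A + AA*‖`. -/
theorem stmt16 (A : H →L[ℂ] H) :
    numRadius A = (1 / 2) * Real.sqrt ‖adjoint A ∘L A + A ∘L adjoint A‖ ↔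
      closure (numRange A) =
        {z : ℂ | ‖z‖ ≤ (1 / 2) * Real.sqrt ‖adjoint A ∘L A + A ∘L adjoint A‖} := by
  have hball : ∀ r : ℝ, {z : ℂ | ‖z‖ ≤ r} = Metric.closedBall 0 r := fun r => by
    ext; simp
  rw [hball]
  have hr : 0 ≤ 1 / 2 * √‖adjoint A ∘L A + A ∘L adjoint A‖ := by positivity
  refine ⟨fun h => closure_numRange_eq_of_numRadius_eq A hr h ?_,
    numRadius_eq_of_closure_numRange_eq A hr⟩
  rw [mul_pow, Real.sq_sqrt (norm_nonneg _)]
  ring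
end
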